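/- Let λ : ℕ → ℝ be nondecreasing on {1,2,3,...}. For every finite prefix-closed set S of binary strings containing the empty string ε, if S has n non-root elements, then the total cost of the non-root nodes satisfies Σ_{v ∈ S, v ≠ ε} λ(depth(v)) ≤ Σ_{h=1}^{n} λ(h); that is, the worst case over all subtrees with n non-root nodes is the non-branching path that contains one node at each depth 1, 2, ..., n. -/

import Mathlib

/-- A finite set of lists closed under nonempty prefixes has at least as many elements as
the length of any of its members. -/
theorem length_le_card_of_prefix_closed {α : Type*} {T : Finset (List α)}
    (hT : ∀ v ∈ T, ∀ w : List α, w ≠ [] → w <+: v → w ∈ T) {v : List α} (hv : v ∈ T) :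
    v.length ≤ T.card := by
  have hcard : (Finset.Icc 1 v.length).card ≤ T.card := by
    refine Finset.card_le_card_of_injOn (fun k => v.take k) ?_ ?_
    · intro k hk
      rw [Finset.mem_coe, Finset.mem_Icc] at hk
      refine hT v hv _ ?_ (List.take_prefix k v)
      rw [← List.length_pos_iff, List.length_take]
      omega
    · intro i hi j hj hij
      rw [Finset.mem_coe, Finset.mem_Icc] at hi hj
      have hlen := congrArg List.length hij
      simp only [List.length_take] at hlen
      omega
  simpa using hcard

/-- Among the finite sets of nonempty lists closed under nonempty prefixes, a chain maximizes
the sum of a function of the length that is monotone on the positive integers. -/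
theorem sum_length_le_sum_Icc_card {α : Type*} {lam : ℕ → ℝ}
    (hmono : ∀ h₁ h₂ : ℕ, 1 ≤ h₁ → h₁ ≤ h₂ → lam h₁ ≤ lam h₂) (n : ℕ) :
    ∀ T : Finset (List α), [] ∉ T → (∀ v ∈ T, ∀ w : List α, w ≠ [] → w <+: v → w ∈ T) →
      T.card = n → ∑ v ∈ T, lam v.length ≤ ∑ h ∈ Finset.Icc 1 n, lam h := by
  classical
  induction n with
  | zero =>
    intro T _ _ hcard
    simp [Finset.card_eq_zero.mp hcard]
  | succ n ih =>
    intro T hnil hT hcard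
    obtain ⟨v, hv, hmax⟩ := T.exists_max_image List.length (Finset.card_pos.mp (by omega))
    have hpos : 1 ≤ v.length :=
      List.length_pos_iff.mpr (ne_of_mem_of_not_mem hv hnil)
    have hle : v.length ≤ n + 1 := hcard ▸ length_le_card_of_prefix_closed hT hv
    have herase := ih (T.erase v) (fun h => hnil (Finset.mem_of_mem_erase h))
      (fun u hu w hw hwu => by
        obtain ⟨huv, huT⟩ := Finset.mem_erase.mp hu
        refine Finset.mem_erase.mpr ⟨?_, hT u huT w hw hwu⟩
        rintro rfl
        exact huv (hwu.eq_of_length_le (hmax u huT)).symm)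
      (by rw [Finset.card_erase_of_mem hv, hcard, Nat.add_sub_cancel])
    rw [← Finset.sum_erase_add T _ hv, Finset.sum_Icc_succ_top (by omega)]
    exact add_le_add herase (hmono _ _ hpos hle)

/-- For a nondecreasing (on `{1,2,...}`) cost function `lam`, and any finite
prefix-closed set `S` of binary strings containing the root `[]`, with `n` non-root elements,
the total cost `∑_{v ∈ S, v ≠ []} lam (depth v)` is at most `∑_{h=1}^{n} lam h`. -/
theorem stmt_0 (lam : ℕ → ℝ)
    (hmono : ∀ h₁ h₂ : ℕ, 1 ≤ h₁ → h₁ ≤ h₂ → lam h₁ ≤ lam h₂)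
    (S : Finset (List Bool)) (hroot : ([] : List Bool) ∈ S)
    (hpc : ∀ v ∈ S, ∀ w : List Bool, w <+: v → w ∈ S)
    (n : ℕ) (hn : (S.filter (fun v => v ≠ [])).card = n) :
    ∑ v ∈ S.filter (fun v => v ≠ []), lam v.length ≤ ∑ h ∈ Finset.Icc 1 n, lam h := by
  refine sum_length_le_sum_Icc_card hmono n _ (by simp) (fun v hv w hw hwv => ?_) hn
  exact Finset.mem_filter.mpr ⟨hpc v (Finset.mem_filter.mp hv).1 w hwv, hw⟩
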